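/- For every M ≥ 1, T > 0, c > 1 and integer j ≥ 0 there exists a constant C > 0, depending only on M, T, c and j, such that for all admissible parameters (α, θ, ℓ), every t ∈ (0, T] and every x ∈ ℝ, one has |x| · (𝒞_θ^j Γ^{α,θ,ℓ}(t,·))(x) ≤ C · [ (𝒞_{cθ}^j Γ^{cα, cθ, ℓ}(t,·))(x) + (𝒞_{4cθ}^j Γ^{cα, 4cθ, ℓ}(t,·))(x) ]. -/

import Mathlib

open Real MeasureTheory

/-- Gaussian density component `Γ_n^{α,θ,ℓ}(t,x)`. -/
noncomputable def Gn (α θ l : ℝ) (n : ℕ) (t x : ℝ) : ℝ :=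
  (Real.sqrt (2 * Real.pi * (α * t + (n : ℝ) * θ)))⁻¹ *
    Real.exp (-(x - (α / 2 + l * (Real.exp (θ / 2) - 1)) * t) ^ 2 / (2 * (α * t + (n : ℝ) * θ)))

/-- Compound-Poisson jump-diffusion density `Γ^{α,θ,ℓ}(t,x)`. -/
noncomputable def G (α θ l : ℝ) (t x : ℝ) : ℝ :=
  Real.exp (-(l * t)) * ∑' n : ℕ, (l * t) ^ n / (Nat.factorial n : ℝ) * Gn α θ l n t x

/-- Centered Gaussian density component `Γ̄_n^{α,θ}(t,x)`. -/
noncomputable def GBn (α θ : ℝ) (n : ℕ) (t x : ℝ) : ℝ :=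
  (Real.sqrt (2 * Real.pi * (α * t + (n : ℝ) * θ)))⁻¹ *
    Real.exp (-x ^ 2 / (2 * (α * t + (n : ℝ) * θ)))

/-- Centered jump-diffusion density `Γ̄^{α,θ,ℓ}(t,x)`. -/
noncomputable def GB (α θ l : ℝ) (t x : ℝ) : ℝ :=
  Real.exp (-(l * t)) * ∑' n : ℕ, (l * t) ^ n / (Nat.factorial n : ℝ) * GBn α θ n t x

/-- Gaussian convolution operator `𝒞_θ`. -/
noncomputable def conv (θ : ℝ) (f : ℝ → ℝ) (x : ℝ) : ℝ :=
  ∫ z : ℝ, f (x + z) * ((Real.sqrt (2 * Real.pi * θ))⁻¹ * Real.exp (-z ^ 2 / (2 * θ)))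

/-- Centered Gaussian density with variance `s`. -/
noncomputable def gaussDensity (s y : ℝ) : ℝ :=
  (Real.sqrt (2 * Real.pi * s))⁻¹ * Real.exp (-y ^ 2 / (2 * s))

lemma gaussDensity_nonneg (s y : ℝ) : 0 ≤ gaussDensity s y := by
  unfold gaussDensity; positivity

lemma gaussDensity_le {σ s : ℝ} (hσ : 0 < σ) (hs : σ ≤ s) (y : ℝ) :
    gaussDensity s y ≤ (Real.sqrt (2 * Real.pi * σ))⁻¹ := by
  unfold gaussDensity
  have hs0 : 0 < s := hσ.trans_le hs
  have h1 : Real.exp (-y ^ 2 / (2 * s)) ≤ 1 :=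
    Real.exp_le_one_iff.2 (div_nonpos_of_nonpos_of_nonneg (by nlinarith [sq_nonneg y]) (by linarith))
  calc _ ≤ (Real.sqrt (2 * Real.pi * s))⁻¹ * 1 := by gcongr
    _ ≤ _ := by rw [mul_one]; gcongr

/-- Completing the square in the product of two Gaussian densities. -/
lemma gaussDensity_mul_gaussDensity {s θ : ℝ} (hs : 0 < s) (hθ : 0 < θ) (y z : ℝ) :
    gaussDensity s (y + z) * gaussDensity θ z =
      gaussDensity (s + θ) y * (Real.sqrt (Real.pi / ((s + θ) / (2 * s * θ))))⁻¹ *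
        Real.exp (-((s + θ) / (2 * s * θ)) * (z + y * θ / (s + θ)) ^ 2) := by
  unfold gaussDensity
  have hsθ : 0 < s + θ := by linarith
  have h1 : (Real.sqrt (2 * Real.pi * s))⁻¹ * (Real.sqrt (2 * Real.pi * θ))⁻¹ =
      (Real.sqrt (2 * Real.pi * (s + θ)))⁻¹ *
        (Real.sqrt (Real.pi / ((s + θ) / (2 * s * θ))))⁻¹ := by
    rw [← mul_inv, ← mul_inv, ← Real.sqrt_mul (by positivity), ← Real.sqrt_mul (by positivity)]
    congr 2
    field_simp
  have h2 : Real.exp (-(y + z) ^ 2 / (2 * s)) * Real.exp (-z ^ 2 / (2 * θ)) =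
      Real.exp (-y ^ 2 / (2 * (s + θ))) *
        Real.exp (-((s + θ) / (2 * s * θ)) * (z + y * θ / (s + θ)) ^ 2) := by
    rw [← Real.exp_add, ← Real.exp_add]
    congr 1
    field_simp
    ring
  calc _ = ((Real.sqrt (2 * Real.pi * s))⁻¹ * (Real.sqrt (2 * Real.pi * θ))⁻¹) *
        (Real.exp (-(y + z) ^ 2 / (2 * s)) * Real.exp (-z ^ 2 / (2 * θ))) := by ring
    _ = _ := by rw [h1, h2]; ring

lemma integrable_gaussDensity_mul {s θ : ℝ} (hs : 0 < s) (hθ : 0 < θ) (y : ℝ) :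
    Integrable fun z => gaussDensity s (y + z) * gaussDensity θ z := by
  simp_rw [gaussDensity_mul_gaussDensity hs hθ]
  exact ((integrable_exp_neg_mul_sq (b := (s + θ) / (2 * s * θ))
    (by positivity)).comp_add_right _).const_mul _

lemma integral_gaussDensity_mul {s θ : ℝ} (hs : 0 < s) (hθ : 0 < θ) (y : ℝ) :
    ∫ z, gaussDensity s (y + z) * gaussDensity θ z = gaussDensity (s + θ) y := by
  simp_rw [gaussDensity_mul_gaussDensity hs hθ]
  rw [integral_const_mul, integral_add_right_eq_self
    (fun z : ℝ => Real.exp (-((s + θ) / (2 * s * θ)) * z ^ 2)), integral_gaussian, mul_assoc,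
    inv_mul_cancel₀ (by positivity), mul_one]

/-- Mixture of Gaussian densities with mean `m`, weights `w` and variances `s`. -/
noncomputable def gaussMixture (w s : ℕ → ℝ) (m x : ℝ) : ℝ :=
  ∑' n, w n * gaussDensity (s n) (x - m)

lemma summable_gaussMixture {w s : ℕ → ℝ} {σ : ℝ} (hw : Summable w) (hw0 : ∀ n, 0 ≤ w n)
    (hσ : 0 < σ) (hs : ∀ n, σ ≤ s n) (y : ℝ) : Summable fun n => w n * gaussDensity (s n) y :=
  Summable.of_nonneg_of_le (fun n => mul_nonneg (hw0 n) (gaussDensity_nonneg _ _))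
    (fun n => mul_le_mul_of_nonneg_left (gaussDensity_le hσ (hs n) y) (hw0 n)) (hw.mul_right _)

lemma conv_gaussMixture {w s : ℕ → ℝ} {σ θ : ℝ} (hw : Summable w) (hw0 : ∀ n, 0 ≤ w n)
    (hσ : 0 < σ) (hs : ∀ n, σ ≤ s n) (hθ : 0 < θ) (m : ℝ) :
    conv θ (gaussMixture w s m) = gaussMixture w (fun n => s n + θ) m := by
  funext x
  have hF (n : ℕ) (z : ℝ) : w n * gaussDensity (s n) (x + z - m) * gaussDensity θ z =
      w n * (gaussDensity (s n) (x - m + z) * gaussDensity θ z) := by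
    rw [mul_assoc, show x + z - m = x - m + z by ring]
  have hs0 (n : ℕ) : 0 < s n := hσ.trans_le (hs n)
  have hint (n : ℕ) : ∫ z, w n * gaussDensity (s n) (x + z - m) * gaussDensity θ z =
      w n * gaussDensity (s n + θ) (x - m) := by
    simp_rw [hF, integral_const_mul, integral_gaussDensity_mul (hs0 n) hθ]
  have key := hasSum_integral_of_summable_integral_norm (μ := volume)
    (F := fun n z => w n * gaussDensity (s n) (x + z - m) * gaussDensity θ z)
    (fun n => by
      simp_rw [hF]
      exact (integrable_gaussDensity_mul (hs0 n) hθ _).const_mul _)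
    (by
      have hn (n : ℕ) (z : ℝ) : ‖w n * gaussDensity (s n) (x + z - m) * gaussDensity θ z‖ =
          w n * gaussDensity (s n) (x + z - m) * gaussDensity θ z :=
        Real.norm_of_nonneg (mul_nonneg (mul_nonneg (hw0 n) (gaussDensity_nonneg _ _))
          (gaussDensity_nonneg _ _))
      simp_rw [hn, hint]
      exact summable_gaussMixture hw hw0 hσ (fun n => (hs n).trans (by linarith)) _)
  simp_rw [hint] at key
  unfold gaussMixture
  rw [key.tsum_eq]
  simp_rw [tsum_mul_right]
  rfl

lemma conv_iterate_gaussMixture {w s : ℕ → ℝ} {σ θ : ℝ} (hw : Summable w) (hw0 : ∀ n, 0 ≤ w n)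
    (hσ : 0 < σ) (hs : ∀ n, σ ≤ s n) (hθ : 0 < θ) (m : ℝ) (j : ℕ) :
    (conv θ)^[j] (gaussMixture w s m) = gaussMixture w (fun n => s n + j * θ) m := by
  induction j with
  | zero => simp
  | succ k ih =>
    rw [Function.iterate_succ_apply', ih, conv_gaussMixture hw hw0 hσ
      (fun n => (hs n).trans (by nlinarith [mul_nonneg k.cast_nonneg hθ.le])) hθ]
    congr 1
    funext n
    push_cast
    ring

/-- Poisson weight. -/
noncomputable def poissonWeight (r : ℝ) (n : ℕ) : ℝ :=
  Real.exp (-r) * (r ^ n / (Nat.factorial n : ℝ))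

lemma poissonWeight_nonneg {r : ℝ} (hr : 0 ≤ r) (n : ℕ) : 0 ≤ poissonWeight r n := by
  unfold poissonWeight; positivity

lemma summable_poissonWeight (r : ℝ) : Summable (poissonWeight r) :=
  (Real.summable_pow_div_factorial r).mul_left _

lemma add_two_mul_poissonWeight_succ_le {r : ℝ} (hr : 0 ≤ r) (n : ℕ) :
    ((n : ℝ) + 2) * poissonWeight r (n + 1) ≤ 2 * r * poissonWeight r n := by
  have h : ((n : ℝ) + 1) * poissonWeight r (n + 1) = r * poissonWeight r n := by
    unfold poissonWeight
    rw [Nat.factorial_succ, pow_succ]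
    push_cast
    field_simp
  nlinarith [mul_nonneg n.cast_nonneg (poissonWeight_nonneg hr (n + 1))]

/-- The drift of the jump-diffusion. -/
noncomputable def drift (α θ l : ℝ) : ℝ := α / 2 + l * (Real.exp (θ / 2) - 1)

lemma conv_iterate_G {α θ l t : ℝ} (hα : 0 < α) (hθ : 0 < θ) (hl : 0 ≤ l) (ht : 0 < t) (j : ℕ) :
    (conv θ)^[j] (G α θ l t) = gaussMixture (poissonWeight (l * t))
      (fun n => α * t + ((n : ℝ) + j) * θ) (drift α θ l * t) := by
  have h : G α θ l t = gaussMixture (poissonWeight (l * t)) (fun n => α * t + (n : ℝ) * θ)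
      (drift α θ l * t) := by
    funext x
    unfold G gaussMixture poissonWeight
    rw [← tsum_mul_left]
    simp_rw [mul_assoc]
    rfl
  rw [h, conv_iterate_gaussMixture (summable_poissonWeight _)
    (poissonWeight_nonneg (by positivity)) (mul_pos hα ht)
    (fun n => le_add_of_nonneg_right (by positivity)) hθ]
  congr 1
  funext n
  ring

lemma drift_mem {α θ l A B L : ℝ} (hα : 0 ≤ α) (hαA : α ≤ A) (hθ : 0 ≤ θ) (hθB : θ ≤ B)
    (hl : 0 ≤ l) (hlL : l ≤ L) : drift α θ l ∈ Set.Icc 0 (A / 2 + L * Real.exp (B / 2)) := by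
  unfold drift
  have h1 : 1 ≤ Real.exp (θ / 2) := Real.one_le_exp (by positivity)
  have h2 : Real.exp (θ / 2) ≤ Real.exp (B / 2) := by gcongr
  constructor
  · nlinarith [mul_nonneg hl (sub_nonneg.2 h1)]
  · have : l * (Real.exp (θ / 2) - 1) ≤ L * Real.exp (B / 2) :=
      mul_le_mul hlL (by linarith) (by linarith) (hl.trans hlL)
    linarith

/-- A Gaussian density times `|x|` is controlled by a Gaussian density with larger variance and
shifted mean. -/
lemma abs_mul_gaussDensity_le {c D B : ℝ} (hc : 1 < c) (hD : 0 ≤ D) :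
    ∃ K : ℝ, 0 < K ∧ ∀ s s' a b x : ℝ, 0 < s → c * s ≤ s' → s' ≤ 4 * c * s → |a| ≤ D →
      (a - b) ^ 2 ≤ B * s →
      |x| * gaussDensity s (x - a) ≤ K * (1 + s) * gaussDensity s' (x - b) := by
  set ε := (c - 1) / 2 with hε
  set δ := (c - 1) / (2 * c) with hδ
  have hc0 : 0 < c := by linarith
  have hε0 : 0 < ε := by rw [hε]; linarith
  have hδ0 : 0 < δ := by rw [hδ]; exact div_pos (by linarith) (by linarith)
  set E := (1 + 1 / ε) * B / (2 * c) with hE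
  refine ⟨Real.sqrt (4 * c) * (1 + D + 2 / δ) * Real.exp E, by positivity, ?_⟩
  intro s s' a b x hs hs' hs'' ha hab
  have hs'0 : 0 < s' := (mul_pos hc0 hs).trans_le hs'
  have hsq : (Real.sqrt (2 * Real.pi * s))⁻¹ ≤
      Real.sqrt (4 * c) * (Real.sqrt (2 * Real.pi * s'))⁻¹ := by
    rw [inv_le_iff_one_le_mul₀ (by positivity), mul_right_comm, ← div_eq_mul_inv,
      one_le_div (by positivity), ← Real.sqrt_mul (by positivity)]
    apply Real.sqrt_le_sqrt
    nlinarith [Real.pi_pos]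
  have hyoung : (x - b) ^ 2 ≤ (1 + ε) * (x - a) ^ 2 + (1 + 1 / ε) * (a - b) ^ 2 := by
    have : (1 + ε) * (x - a) ^ 2 + (1 + 1 / ε) * (a - b) ^ 2 - (x - b) ^ 2 =
        (ε * (x - a) - (a - b)) ^ 2 / ε := by
      field_simp
      ring
    have h2 : 0 ≤ (ε * (x - a) - (a - b)) ^ 2 / ε := by positivity
    linarith
  have hexp : -(x - a) ^ 2 / (2 * s) ≤
      -(δ * ((x - a) ^ 2 / (2 * s))) + (E + -(x - b) ^ 2 / (2 * s')) := by
    have h1 : (x - b) ^ 2 / (2 * s') ≤ (x - b) ^ 2 / (2 * (c * s)) := by gcongr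
    have h2 : (x - b) ^ 2 / (2 * (c * s)) ≤
        ((1 + ε) * (x - a) ^ 2 + (1 + 1 / ε) * (B * s)) / (2 * (c * s)) := by
      gcongr
      exact hyoung.trans (by gcongr)
    have h3 : ((1 + ε) * (x - a) ^ 2 + (1 + 1 / ε) * (B * s)) / (2 * (c * s)) =
        (1 - δ) * ((x - a) ^ 2 / (2 * s)) + E := by
      have : 1 + ε = c * (1 - δ) := by
        rw [hε, hδ]; field_simp; ring
      rw [this, hE]
      field_simp
    have h4 : -(x - a) ^ 2 / (2 * s) = -((x - a) ^ 2 / (2 * s)) := neg_div _ _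
    have h5 : -(x - b) ^ 2 / (2 * s') = -((x - b) ^ 2 / (2 * s')) := neg_div _ _
    rw [h4, h5]
    linarith
  have habs : |x| * Real.exp (-(δ * ((x - a) ^ 2 / (2 * s)))) ≤ (1 + D + 2 / δ) * (1 + s) := by
    set u := δ * ((x - a) ^ 2 / (2 * s)) with hu
    have hu0 : 0 ≤ u := by positivity
    have hy : (x - a) ^ 2 = 2 * s / δ * u := by
      rw [hu]; field_simp
    have hx : |x| ≤ 1 + D + (x - a) ^ 2 := by
      have h1 : |x| ≤ |x - a| + |a| := by simpa using abs_add_le (x - a) a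
      nlinarith [sq_nonneg (|x - a| - 1), sq_abs (x - a), abs_nonneg (x - a)]
    have he : Real.exp (-u) ≤ 1 := Real.exp_le_one_iff.2 (by linarith)
    have hue : u * Real.exp (-u) ≤ 1 := by
      rw [Real.exp_neg, ← div_eq_mul_inv, div_le_one (Real.exp_pos _)]
      linarith [Real.add_one_le_exp u]
    calc |x| * Real.exp (-u) ≤ (1 + D + (x - a) ^ 2) * Real.exp (-u) := by gcongr
      _ = (1 + D) * Real.exp (-u) + 2 * s / δ * (u * Real.exp (-u)) := by rw [hy]; ring
      _ ≤ (1 + D) * 1 + 2 * s / δ * 1 := by gcongr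
      _ ≤ (1 + D + 2 / δ) * (1 + s) := by
        have : 2 * s / δ = 2 / δ * s := by ring
        rw [this]
        have : 0 < 2 / δ := by positivity
        nlinarith
  unfold gaussDensity
  calc |x| * ((Real.sqrt (2 * Real.pi * s))⁻¹ * Real.exp (-(x - a) ^ 2 / (2 * s)))
      ≤ |x| * ((Real.sqrt (4 * c) * (Real.sqrt (2 * Real.pi * s'))⁻¹) *
        Real.exp (-(δ * ((x - a) ^ 2 / (2 * s))) + (E + -(x - b) ^ 2 / (2 * s')))) := by
        gcongr
    _ = (|x| * Real.exp (-(δ * ((x - a) ^ 2 / (2 * s))))) * (Real.sqrt (4 * c) *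
        (Real.sqrt (2 * Real.pi * s'))⁻¹ * (Real.exp E * Real.exp (-(x - b) ^ 2 / (2 * s')))) := by
        rw [Real.exp_add, Real.exp_add]; ring
    _ ≤ ((1 + D + 2 / δ) * (1 + s)) * (Real.sqrt (4 * c) *
        (Real.sqrt (2 * Real.pi * s'))⁻¹ * (Real.exp E * Real.exp (-(x - b) ^ 2 / (2 * s')))) := by
        gcongr
    _ = _ := by ring

/-- Lemma 5.12: `|x| 𝒞_θ^j Γ^{α,θ,ℓ}(t,x) ≤ C (𝒞_{cθ}^j Γ^{cα,cθ,ℓ}(t,x) + 𝒞_{4cθ}^j Γ^{cα,4cθ,ℓ}(t,x))`. -/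
theorem stmt5 (M T c : ℝ) (j : ℕ) (hM : 1 ≤ M) (hT : 0 < T) (hc : 1 < c) :
    ∃ C : ℝ, 0 < C ∧
      ∀ α θ l : ℝ, M⁻¹ ≤ α → α ≤ M → M⁻¹ ≤ θ → θ ≤ M → 0 ≤ l → l ≤ M →
        ∀ t ∈ Set.Ioc (0 : ℝ) T, ∀ x : ℝ,
          |x| * (conv θ)^[j] (G α θ l t) x ≤
            C * ((conv (c * θ))^[j] (G (c * α) (c * θ) l t) x +
              (conv (4 * c * θ))^[j] (G (c * α) (4 * c * θ) l t) x) := by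
  have hM0 : 0 < M := by linarith
  have hc0 : 0 < c := by linarith
  set R := c * M / 2 + M * Real.exp (4 * c * M / 2) with hR
  have hR0 : 0 < R := by positivity
  obtain ⟨K, hK, hKle⟩ := abs_mul_gaussDensity_le (c := c) (D := R * T) (B := R ^ 2 * T * M) hc
    (by positivity)
  set L := 1 + M * T + j * M + M with hL
  have hL0 : 0 < L := by positivity
  refine ⟨2 * (K * L) * (1 + M * T), by positivity, ?_⟩
  rintro α θ l hα hαM hθ hθM hl hlM t ⟨ht, htT⟩ x
  have hα0 : 0 < α := (inv_pos.2 hM0).trans_le hα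
  have hθ0 : 0 < θ := (inv_pos.2 hM0).trans_le hθ
  rw [conv_iterate_G hα0 hθ0 hl ht, conv_iterate_G (by positivity) (by positivity) hl ht,
    conv_iterate_G (by positivity) (by positivity) hl ht]
  have hcM : M ≤ c * M := by nlinarith
  have hcα : c * α ≤ c * M := by gcongr
  have hcθ : c * θ ≤ c * M := by gcongr
  have hcMp : 0 < c * M := by positivity
  have h0 : drift α θ l ∈ Set.Icc 0 R :=
    drift_mem hα0.le (by linarith) hθ0.le (by linarith) hl hlM
  have h1 : drift (c * α) (c * θ) l ∈ Set.Icc 0 R :=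
    drift_mem (by positivity) hcα (by positivity) (by linarith) hl hlM
  have h2 : drift (c * α) (4 * c * θ) l ∈ Set.Icc 0 R :=
    drift_mem (by positivity) hcα (by positivity) (by linarith) hl hlM
  set a := drift α θ l
  set b₁ := drift (c * α) (c * θ) l
  set b₂ := drift (c * α) (4 * c * θ) l
  set r := l * t with hr
  have hr0 : 0 ≤ r := by positivity
  have hrM : r ≤ M * T := mul_le_mul hlM htT ht.le hM0.le
  have hw0 := poissonWeight_nonneg hr0
  set s : ℕ → ℝ := fun n => α * t + ((n : ℝ) + j) * θ with hs
  have hs0 (n : ℕ) : 0 < s n := by positivity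
  have hsL (n : ℕ) : 1 + s n ≤ L * (n + 1) := by
    have e1 : α * t ≤ M * T := mul_le_mul hαM htT ht.le hM0.le
    have e2 : ((n : ℝ) + j) * θ ≤ (n + j) * M := by gcongr
    have e3 : (0 : ℝ) ≤ n * (1 + M * T + j * M) := by positivity
    simp only [hs, hL]
    nlinarith
  have ha : |a * t| ≤ R * T := by
    rw [abs_of_nonneg (mul_nonneg h0.1 ht.le)]
    exact mul_le_mul h0.2 htT ht.le hR0.le
  have hdiff (b : ℝ) (hb : b ∈ Set.Icc 0 R) (n : ℕ) :
      (a * t - b * t) ^ 2 ≤ R ^ 2 * T * M * s n := by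
    have e1 : (a - b) ^ 2 ≤ R ^ 2 :=
      sq_le_sq' (by linarith [h0.1, hb.2]) (by linarith [h0.2, hb.1])
    have e2 : t ≤ M * s n := by
      have : t ≤ M * (α * t) := by
        have : 1 ≤ M * α := by
          calc (1 : ℝ) = M * M⁻¹ := (mul_inv_cancel₀ hM0.ne').symm
            _ ≤ _ := by gcongr
        nlinarith
      refine this.trans ?_
      gcongr
      exact le_add_of_nonneg_right (by positivity)
    calc (a * t - b * t) ^ 2 = (a - b) ^ 2 * (t * t) := by ring
      _ ≤ R ^ 2 * (T * (M * s n)) := by gcongr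
      _ = _ := by ring
  have hbound (n : ℕ) (b s' : ℝ) (hb : b ∈ Set.Icc 0 R) (hl' : c * s n ≤ s')
      (hu' : s' ≤ 4 * c * s n) : |x| * gaussDensity (s n) (x - a * t) ≤
        K * L * (n + 1) * gaussDensity s' (x - b * t) := by
    refine (hKle (s n) s' (a * t) (b * t) x (hs0 n) hl' hu' ha (hdiff b hb n)).trans ?_
    have := gaussDensity_nonneg s' (x - b * t)
    rw [mul_assoc K L]
    gcongr
    exact hsL n
  unfold gaussMixture
  set f : ℕ → ℝ := fun n => poissonWeight r n * gaussDensity (s n) (x - a * t) with hf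
  set g₁ : ℕ → ℝ := fun n => poissonWeight r n *
    gaussDensity (c * α * t + ((n : ℝ) + j) * (c * θ)) (x - b₁ * t) with hg₁
  set g₂ : ℕ → ℝ := fun n => poissonWeight r n *
    gaussDensity (c * α * t + ((n : ℝ) + j) * (4 * c * θ)) (x - b₂ * t) with hg₂
  have hsf : Summable f := summable_gaussMixture (summable_poissonWeight r) hw0 (mul_pos hα0 ht)
    (fun n => le_add_of_nonneg_right (by positivity)) _
  have hsg₁ : Summable g₁ := summable_gaussMixture (summable_poissonWeight r) hw0
    (σ := c * α * t) (by positivity) (fun n => le_add_of_nonneg_right (by positivity)) _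
  have hsg₂ : Summable g₂ := summable_gaussMixture (summable_poissonWeight r) hw0
    (σ := c * α * t) (by positivity) (fun n => le_add_of_nonneg_right (by positivity)) _
  have hg₁0 (n : ℕ) : 0 ≤ g₁ n := mul_nonneg (hw0 n) (gaussDensity_nonneg _ _)
  have hg₂0 (n : ℕ) : 0 ≤ g₂ n := mul_nonneg (hw0 n) (gaussDensity_nonneg _ _)
  have hfg₁ (n : ℕ) : |x| * f n ≤ K * L * (n + 1) * g₁ n := by
    have := mul_le_mul_of_nonneg_left (hbound n b₁ (c * α * t + ((n : ℝ) + j) * (c * θ)) h1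
      (le_of_eq (by simp only [hs]; ring)) (by
        have := mul_pos hc0 (hs0 n)
        have e : c * α * t + ((n : ℝ) + j) * (c * θ) = c * s n := by simp only [hs]; ring
        rw [e]; linarith)) (hw0 n)
    simp only [hf, hg₁]
    linarith
  have hfg₂ (n : ℕ) (hn : 1 ≤ n + j) : |x| * f (n + 1) ≤ 2 * (K * L) * (M * T) * g₂ n := by
    have hn' : (1 : ℝ) ≤ (n : ℝ) + j := by exact_mod_cast hn
    have hcθ0 : 0 < c * θ := by positivity
    have hb := hbound (n + 1) b₂ (c * α * t + ((n : ℝ) + j) * (4 * c * θ)) h2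
      (by simp only [hs]; push_cast; nlinarith)
      (by
        have : 0 < c * α * t := by positivity
        simp only [hs]; push_cast; nlinarith)
    set q := gaussDensity (c * α * t + ((n : ℝ) + j) * (4 * c * θ)) (x - b₂ * t) with hq
    have hq0 : 0 ≤ q := gaussDensity_nonneg _ _
    calc |x| * f (n + 1)
        = poissonWeight r (n + 1) * (|x| * gaussDensity (s (n + 1)) (x - a * t)) := by
          simp only [hf]; ring
      _ ≤ poissonWeight r (n + 1) * (K * L * ((n + 1 : ℕ) + 1) * q) :=
          mul_le_mul_of_nonneg_left hb (hw0 _)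
      _ = K * L * (((n : ℝ) + 2) * poissonWeight r (n + 1)) * q := by push_cast; ring
      _ ≤ K * L * (2 * r * poissonWeight r n) * q := by
          gcongr K * L * ?_ * q
          exact add_two_mul_poissonWeight_succ_le hr0 n
      _ ≤ K * L * (2 * (M * T) * poissonWeight r n) * q := by
          have := hw0 n
          gcongr
      _ = _ := by simp only [hg₂]; ring
  have hKL : 0 < K * L := by positivity
  have hMT : 0 < M * T := by positivity
  set C := 2 * (K * L) * (1 + M * T) with hC
  have hC1 : 2 * (K * L) ≤ C := by rw [hC]; nlinarith
  have hC2 : 2 * (K * L) * (M * T) ≤ C := by rw [hC]; nlinarith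
  have hC0 : 0 < C := by positivity
  have hzero : |x| * f 0 ≤ C * g₁ 0 := by
    refine (hfg₁ 0).trans (mul_le_mul_of_nonneg_right ?_ (hg₁0 0))
    push_cast
    linarith
  have hsucc (n : ℕ) : |x| * f (n + 1) ≤ C * (g₁ (n + 1) + g₂ n) := by
    rcases Nat.eq_zero_or_pos (n + j) with hn | hn
    · obtain ⟨rfl, -⟩ : n = 0 ∧ j = 0 := by omega
      refine (hfg₁ (0 + 1)).trans ?_
      have e1 := mul_le_mul_of_nonneg_right hC1 (hg₁0 (0 + 1))
      have e2 := mul_nonneg hC0.le (hg₂0 0)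
      push_cast
      linarith
    · have e1 := mul_le_mul_of_nonneg_right hC2 (hg₂0 n)
      have e2 := mul_nonneg hC0.le (hg₁0 (n + 1))
      linarith [hfg₂ n hn]
  have hsg₁' := (summable_nat_add_iff 1).2 hsg₁
  have hsf' := (summable_nat_add_iff 1).2 hsf
  have hsum : |x| * ∑' n, f (n + 1) ≤ C * (∑' n, g₁ (n + 1) + ∑' n, g₂ n) := by
    rw [← hsg₁'.tsum_add hsg₂, ← tsum_mul_left, ← tsum_mul_left]
    exact (hsf'.mul_left _).tsum_le_tsum hsucc ((hsg₁'.add hsg₂).mul_left _)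
  rw [hsf.tsum_eq_zero_add, hsg₁.tsum_eq_zero_add]
  linarith
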